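/- Let Q ∈ L²_loc(ℝ; ℝ), q = Q', and let y₁ be a solution of L_q y = 0 on ℝ (in the system sense) with y₁(x) > 0 for all x and y₁(0) = 1. Define F(x) = ∫₀ˣ y₁(s)⁻² ds, m₊ = lim_{x→+∞} F(x) ∈ (0, +∞] and m₋ = −lim_{x→−∞} F(x) ∈ (0, +∞] (with the convention m₊⁻¹ = 0 if m₊ = +∞, and similarly for m₋⁻¹). Then a function y : ℝ → ℝ is a solution of L_q y = 0 with y(x) > 0 for all x and y(0) = 1 if and only if y = y₁ · (1 + c·F) for some c ∈ [−m₊⁻¹, m₋⁻¹]. Consequently, the set Pos(q) of such normalized positive solutions is a single point when m₊ = m₋ = +∞ and otherwise is the segment {θ y₊ + (1−θ) y₋ : θ ∈ [0,1]} with y₊ = y₁(1 − m₊⁻¹F), y₋ = y₁(1 + m₋⁻¹F). -/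

import Mathlib

open MeasureTheory Filter Set intervalIntegral ENNReal

/-- `Q : ℝ → ℝ` is (real-valued and) locally square integrable on `ℝ`. -/
def LocL2 (Q : ℝ → ℝ) : Prop :=
  Measurable Q ∧ ∀ a b : ℝ, IntegrableOn (fun x => Q x ^ 2) (Set.Icc a b) volume

/-- `y` together with the companion function `u` (representing `u = y' - Q·y`) solves the
first-order system `y' = Q y + u`, `u' = -Q² y - Q u` equivalent to `L_q y = 0` with `q = Q'`,
expressed through integral equations (encoding local absolute continuity). -/
def SolvesWith (Q y u : ℝ → ℝ) : Prop :=
  (∀ x : ℝ, y x = y 0 + ∫ t in (0:ℝ)..x, (Q t * y t + u t)) ∧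
  (∀ x : ℝ, u x = u 0 + ∫ t in (0:ℝ)..x, (-(Q t) ^ 2 * y t - Q t * u t))

/-- `y` solves `L_q y = 0` on `ℝ` in the system sense, `q = Q'`. -/
def Solves (Q y : ℝ → ℝ) : Prop := ∃ u : ℝ → ℝ, SolvesWith Q y u

/-- `L_q ≥ 0` for `q = Q'`: for every real-valued test function `φ`,
`∫ φ'² dx - 2 ∫ Q φ φ' dx ≥ 0` (the second term is the pairing `(q, φ²)`). -/
def LqNonneg (Q : ℝ → ℝ) : Prop :=
  ∀ φ : ℝ → ℝ, ContDiff ℝ (⊤ : ℕ∞) φ → HasCompactSupport φ →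
    0 ≤ (∫ x : ℝ, deriv φ x ^ 2) - 2 * ∫ x : ℝ, Q x * φ x * deriv φ x

/-- The Riccati relation `q = B(r) = r' + r²` for `q = Q'`: there is a constant `C` with
`r x + ∫₀ˣ r² = Q x + C` for almost every `x`. -/
def Riccati (Q r : ℝ → ℝ) : Prop :=
  ∃ C : ℝ, ∀ᵐ x : ℝ ∂volume, r x + (∫ s in (0:ℝ)..x, r s ^ 2) = Q x + C


/-! ### Integrability of the right-hand sides -/

lemma LocL2.intervalIntegrable_sq {Q : ℝ → ℝ} (hQ : LocL2 Q) (a b : ℝ) :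
    IntervalIntegrable (fun x => Q x ^ 2) volume a b :=
  intervalIntegrable_iff.mpr ((hQ.2 (min a b) (max a b)).mono_set uIoc_subset_uIcc)

lemma LocL2.intervalIntegrable {Q : ℝ → ℝ} (hQ : LocL2 Q) (a b : ℝ) :
    IntervalIntegrable Q volume a b := by
  refine ((intervalIntegrable_const (c := (1 : ℝ))).add
    (hQ.intervalIntegrable_sq a b)).mono_fun' hQ.1.aestronglyMeasurable (ae_of_all _ fun x => ?_)
  have h : |Q x| ≤ 1 + Q x ^ 2 := by
    rw [← sq_abs]
    nlinarith [sq_nonneg (|Q x| - 1), abs_nonneg (Q x)]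
  simpa using h

/-- A function satisfying `p x = p 0 + ∫₀ˣ f`, where the integral may be undefined beyond `b`,
is still measurable and bounded slightly beyond `b` if it is bounded up to `b`. -/
lemma exists_measurable_bounded_beyond {p f : ℝ → ℝ} {b C : ℝ}
    (hp : ∀ x, p x = p 0 + ∫ t in (0 : ℝ)..x, f t) (hb : 0 ≤ b)
    (hf : ∀ t ∈ Ico 0 b, IntervalIntegrable f volume 0 t) (hC : ∀ t ∈ Ico 0 b, |p t| ≤ C) :
    ∃ t > b, AEStronglyMeasurable p (volume.restrict (Ioc 0 t)) ∧
      ∃ D, ∀ s ∈ Ioc 0 t, |p s| ≤ D := by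
  have hcont : ∀ t, 0 ≤ t → IntervalIntegrable f volume 0 t → ContinuousOn p (Icc 0 t) := by
    intro t ht hi
    have h := continuousOn_primitive_interval' hi left_mem_uIcc
    rw [uIcc_of_le ht] at h
    exact (continuousOn_const.add h).congr fun x _ => hp x
  by_cases h : ∃ t > b, IntervalIntegrable f volume 0 t
  · obtain ⟨t, htb, ht⟩ := h
    have hc := hcont t (hb.trans htb.le) ht
    obtain ⟨D, hD⟩ := isCompact_Icc.exists_bound_of_continuousOn hc
    exact ⟨t, htb, (hc.mono Ioc_subset_Icc_self).aestronglyMeasurable measurableSet_Ioc,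
      D, fun s hs => hD s (Ioc_subset_Icc_self hs)⟩
  · push Not at h
    have hconst : ∀ t > b, p t = p 0 := fun t ht => by
      rw [hp t, integral_undef (h t ht), add_zero]
    refine ⟨b + 1, by linarith, ?_, max C (max |p b| |p 0|), fun s hs => ?_⟩
    · have hIoo : ContinuousOn p (Ioo 0 b) := fun s hs =>
        ((hcont ((s + b) / 2) (by linarith [hs.1, hs.2])
          (hf _ ⟨by linarith [hs.1, hs.2], by linarith [hs.2]⟩)).continuousAt
          (Icc_mem_nhds hs.1 (by linarith [hs.2]))).continuousWithinAt
      have hset : Ioc 0 (b + 1) ⊆ (Ioo 0 b ∪ {b}) ∪ Ioc b (b + 1) := by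
        intro s hs
        rcases lt_trichotomy s b with h' | h' | h'
        · exact Or.inl (Or.inl ⟨hs.1, h'⟩)
        · exact Or.inl (Or.inr h')
        · exact Or.inr ⟨h', hs.2⟩
      refine AEStronglyMeasurable.mono_measure ?_ (Measure.restrict_mono_set _ hset)
      refine aestronglyMeasurable_union_iff.mpr ⟨aestronglyMeasurable_union_iff.mpr
        ⟨hIoo.aestronglyMeasurable measurableSet_Ioo, ?_⟩, ?_⟩
      · exact (continuousOn_singleton p b).aestronglyMeasurable (measurableSet_singleton b)
      · exact (continuousOn_const.congr fun s hs => hconst s hs.1).aestronglyMeasurable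
          measurableSet_Ioc
    · rcases lt_trichotomy s b with h' | h' | h'
      · exact (hC s ⟨hs.1.le, h'⟩).trans (le_max_left _ _)
      · rw [h']; simp
      · rw [hconst s h']; simp

lemma LocL2.intervalIntegrable_rhs {Q y u : ℝ → ℝ} (hQ : LocL2 Q) {t : ℝ} {C D : ℝ} (ht : 0 ≤ t)
    (hy : AEStronglyMeasurable y (volume.restrict (Ioc 0 t))) (hyC : ∀ s ∈ Ioc 0 t, |y s| ≤ C)
    (hu : AEStronglyMeasurable u (volume.restrict (Ioc 0 t))) (huD : ∀ s ∈ Ioc 0 t, |u s| ≤ D) :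
    IntervalIntegrable (fun s => Q s * y s + u s) volume 0 t ∧
      IntervalIntegrable (fun s => -(Q s) ^ 2 * y s - Q s * u s) volume 0 t := by
  have hyC' : ∀ᵐ s ∂volume.restrict (Ioc 0 t), ‖y s‖ ≤ C :=
    (ae_restrict_iff' measurableSet_Ioc).mpr (ae_of_all _ hyC)
  have huD' : ∀ᵐ s ∂volume.restrict (Ioc 0 t), ‖u s‖ ≤ D :=
    (ae_restrict_iff' measurableSet_Ioc).mpr (ae_of_all _ huD)
  have h1 := (intervalIntegrable_iff_integrableOn_Ioc_of_le ht).mp (hQ.intervalIntegrable 0 t)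
  have h2 := (intervalIntegrable_iff_integrableOn_Ioc_of_le ht).mp (hQ.intervalIntegrable_sq 0 t)
  have h0 : IntegrableOn (fun _ : ℝ => (1 : ℝ)) (Ioc 0 t) := by simp
  simp only [intervalIntegrable_iff_integrableOn_Ioc_of_le ht]
  refine ⟨(h1.mul_bdd hy hyC').add ?_, Integrable.sub (h2.neg.mul_bdd hy hyC') (h1.mul_bdd hu huD')⟩
  simpa using h0.mul_bdd hu huD'

/-- Solutions of the system stay bounded on `[0, b)` as long as the integral equations are
meaningful there. -/
lemma SolvesWith.bounded_Ico {Q y u : ℝ → ℝ} (hQ : LocL2 Q) (h : SolvesWith Q y u) {b : ℝ}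
    (hb : 0 ≤ b)
    (hf : ∀ t ∈ Ico 0 b, IntervalIntegrable (fun s => Q s * y s + u s) volume 0 t)
    (hg : ∀ t ∈ Ico 0 b, IntervalIntegrable (fun s => -(Q s) ^ 2 * y s - Q s * u s) volume 0 t) :
    ∃ C, ∀ t ∈ Ico 0 b, |y t| + |u t| ≤ C := by
  rcases hb.eq_or_lt with rfl | hb
  · exact ⟨0, by simp⟩
  set K : ℝ → ℝ := fun s => 1 + |Q s| + Q s ^ 2 with hKdef
  have hK : ∀ a c, IntervalIntegrable K volume a c := fun a c =>
    (intervalIntegrable_const.add (hQ.intervalIntegrable a c).abs).add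
      (hQ.intervalIntegrable_sq a c)
  have hK0 : ∀ s, 0 ≤ K s := fun s => by positivity
  have hcont : ∀ t ∈ Ico 0 b, ContinuousOn (fun s => |y s| + |u s|) (Icc 0 t) := by
    intro t ht
    have h1 := continuousOn_primitive_interval' (hf t ht) left_mem_uIcc
    have h2 := continuousOn_primitive_interval' (hg t ht) left_mem_uIcc
    rw [uIcc_of_le ht.1] at h1 h2
    exact ((continuousOn_const.add h1).congr fun x _ => h.1 x).abs.add
      ((continuousOn_const.add h2).congr fun x _ => h.2 x).abs
  obtain ⟨a, ha, hab⟩ : ∃ a ∈ Ico 0 b, ∫ s in a..b, K s ≤ 1 / 2 := by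
    have hc : Tendsto (fun a => ∫ s in b..a, K s) (nhdsWithin b (Iio b)) (nhds 0) := by
      have := (continuous_primitive hK b).tendsto b
      rw [integral_same] at this
      exact this.mono_left nhdsWithin_le_nhds
    have h1 := hc.eventually (lt_mem_nhds (show (-(1 / 2) : ℝ) < 0 by norm_num))
    obtain ⟨a, ha1, ha2⟩ := (h1.and (Ico_mem_nhdsLT hb)).exists
    refine ⟨a, ha2, ?_⟩
    rw [integral_symm]
    linarith
  obtain ⟨C, hC⟩ := isCompact_Icc.exists_bound_of_continuousOn (hcont a ha)
  have hC' : ∀ t ∈ Icc 0 a, |y t| + |u t| ≤ C := fun t ht => (le_abs_self _).trans (hC t ht)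
  have hCa := hC' a ⟨ha.1, le_rfl⟩
  refine ⟨2 * C, fun t ht => ?_⟩
  rcases le_total t a with hta | hta
  · linarith [hC' t ⟨ht.1, hta⟩, abs_nonneg (y a), abs_nonneg (u a)]
  obtain ⟨s, hs, hmax⟩ := isCompact_Icc.exists_isMaxOn (nonempty_Icc.mpr hta)
    ((hcont t ht).mono (Icc_subset_Icc_left ha.1))
  set M := |y s| + |u s| with hM
  have hmax' : ∀ r ∈ Icc a t, |y r| + |u r| ≤ M := fun r hr => hmax hr
  have hsb : s ∈ Ico 0 b := ⟨ha.1.trans hs.1, hs.2.trans_lt ht.2⟩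
  have hfi : IntervalIntegrable (fun r => Q r * y r + u r) volume a s :=
    (hf a ha).symm.trans (hf s hsb)
  have hgi : IntervalIntegrable (fun r => -(Q r) ^ 2 * y r - Q r * u r) volume a s :=
    (hg a ha).symm.trans (hg s hsb)
  have hys : y s = y a + ∫ r in a..s, (Q r * y r + u r) := by
    rw [h.1 s, h.1 a, add_assoc, integral_add_adjacent_intervals (hf a ha) hfi]
  have hus : u s = u a + ∫ r in a..s, (-(Q r) ^ 2 * y r - Q r * u r) := by
    rw [h.2 s, h.2 a, add_assoc, integral_add_adjacent_intervals (hg a ha) hgi]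
  have hM0 : 0 ≤ M := by positivity
  have key : (∫ r in a..s, |Q r * y r + u r|) + ∫ r in a..s, |-(Q r) ^ 2 * y r - Q r * u r|
      ≤ M / 2 := by
    rw [← integral_add hfi.abs hgi.abs]
    calc _ ≤ ∫ r in a..s, M * K r := by
          refine integral_mono_on hs.1 (hfi.abs.add hgi.abs) ((hK a s).const_mul M) fun r hr => ?_
          have h1 : |Q r * y r + u r| ≤ |Q r| * |y r| + |u r| := by
            rw [← abs_mul]; exact abs_add_le _ _
          have h2 : |-(Q r) ^ 2 * y r - Q r * u r| ≤ Q r ^ 2 * |y r| + |Q r| * |u r| := by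
            refine (abs_sub _ _).trans ?_
            rw [abs_mul, abs_mul, abs_neg, abs_of_nonneg (sq_nonneg (Q r))]
          have h3 := mul_le_mul_of_nonneg_right (hmax' r ⟨hr.1, hr.2.trans hs.2⟩) (hK0 r)
          refine le_trans ?_ h3
          simp only [hKdef]
          nlinarith [abs_nonneg (Q r), abs_nonneg (y r), abs_nonneg (u r), sq_nonneg (Q r),
            mul_nonneg (sq_nonneg (Q r)) (abs_nonneg (u r))]
      _ = M * ∫ r in a..s, K r := integral_const_mul _ _
      _ ≤ M * (1 / 2) := by
          refine mul_le_mul_of_nonneg_left (le_trans ?_ hab) hM0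
          exact integral_mono_interval le_rfl hs.1 hsb.2.le (ae_of_all _ hK0) (hK a b)
      _ = M / 2 := by ring
  have e1 := abs_integral_le_integral_abs (μ := volume) (f := fun r => Q r * y r + u r) hs.1
  have e2 := abs_integral_le_integral_abs (μ := volume)
    (f := fun r => -(Q r) ^ 2 * y r - Q r * u r) hs.1
  have e3 : |y s| ≤ |y a| + |∫ r in a..s, (Q r * y r + u r)| := by
    conv_lhs => rw [hys]
    exact abs_add_le _ _
  have e4 : |u s| ≤ |u a| + |∫ r in a..s, (-(Q r) ^ 2 * y r - Q r * u r)| := by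
    conv_lhs => rw [hus]
    exact abs_add_le _ _
  linarith [hmax' t ⟨hta, le_rfl⟩]

lemma SolvesWith.intervalIntegrable_of_nonneg {Q y u : ℝ → ℝ} (hQ : LocL2 Q)
    (h : SolvesWith Q y u) {x : ℝ} (hx : 0 ≤ x) :
    IntervalIntegrable (fun s => Q s * y s + u s) volume 0 x ∧
      IntervalIntegrable (fun s => -(Q s) ^ 2 * y s - Q s * u s) volume 0 x := by
  set P : ℝ → Prop := fun t => IntervalIntegrable (fun s => Q s * y s + u s) volume 0 t ∧
    IntervalIntegrable (fun s => -(Q s) ^ 2 * y s - Q s * u s) volume 0 t with hP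
  have hmono : ∀ t, P t → ∀ s, 0 ≤ s → s ≤ t → P s := by
    intro t ht s hs hst
    have : uIcc 0 s ⊆ uIcc 0 t := by
      rw [uIcc_of_le hs, uIcc_of_le (hs.trans hst)]
      exact Icc_subset_Icc_right hst
    exact ⟨ht.1.mono_set this, ht.2.mono_set this⟩
  by_contra hxP
  set S := {t | 0 ≤ t ∧ P t}
  have h0 : (0 : ℝ) ∈ S := ⟨le_rfl, by simp [hP]⟩
  have hbdd : BddAbove S := ⟨x, fun t ht => by
    by_contra! hlt
    exact hxP (hmono t ht.2 x hx hlt.le)⟩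
  have hb : 0 ≤ sSup S := le_csSup hbdd h0
  have hlt : ∀ t ∈ Ico 0 (sSup S), P t := fun t ht => by
    obtain ⟨s, hs, hts⟩ := exists_lt_of_lt_csSup ⟨0, h0⟩ ht.2
    exact hmono s hs.2 t ht.1 hts.le
  obtain ⟨C, hC⟩ := h.bounded_Ico hQ hb (fun t ht => (hlt t ht).1) (fun t ht => (hlt t ht).2)
  obtain ⟨t₁, ht₁, hym, D₁, hD₁⟩ := exists_measurable_bounded_beyond h.1 hb
    (fun t ht => (hlt t ht).1) (fun t ht => (le_add_of_nonneg_right (abs_nonneg _)).trans (hC t ht))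
  obtain ⟨t₂, ht₂, hum, D₂, hD₂⟩ := exists_measurable_bounded_beyond h.2 hb
    (fun t ht => (hlt t ht).2) (fun t ht => (le_add_of_nonneg_left (abs_nonneg _)).trans (hC t ht))
  have hbt : sSup S < min t₁ t₂ := lt_min ht₁ ht₂
  have hs₁ : Ioc 0 (min t₁ t₂) ⊆ Ioc 0 t₁ := Ioc_subset_Ioc_right (min_le_left _ _)
  have hs₂ : Ioc 0 (min t₁ t₂) ⊆ Ioc 0 t₂ := Ioc_subset_Ioc_right (min_le_right _ _)
  have hmem : min t₁ t₂ ∈ S := ⟨hb.trans hbt.le, hQ.intervalIntegrable_rhs (hb.trans hbt.le)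
    (hym.mono_set hs₁) (fun s hs => hD₁ s (hs₁ hs)) (hum.mono_set hs₂) (fun s hs => hD₂ s (hs₂ hs))⟩
  exact absurd (le_csSup hbdd hmem) (not_le.mpr hbt)

lemma LocL2.neg_comp_neg {Q : ℝ → ℝ} (hQ : LocL2 Q) : LocL2 (fun x => -Q (-x)) := by
  refine ⟨(hQ.1.comp measurable_neg).neg, fun a b => ?_⟩
  rcases le_or_gt a b with hab | hab
  · have h := (IntervalIntegrable.iff_comp_neg (by simp)).mp (hQ.intervalIntegrable_sq (-a) (-b))
    rw [neg_neg, neg_neg, intervalIntegrable_iff_integrableOn_Icc_of_le hab] at h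
    simpa using h
  · simp [Icc_eq_empty hab.not_ge]

lemma SolvesWith.comp_neg {Q y u : ℝ → ℝ} (h : SolvesWith Q y u) :
    SolvesWith (fun x => -Q (-x)) (fun x => y (-x)) (fun x => -u (-x)) := by
  have key : ∀ (φ ψ : ℝ → ℝ) (x : ℝ), (∀ t, ψ t = -φ (-t)) →
      ∫ t in (0 : ℝ)..x, ψ t = ∫ t in (0 : ℝ)..-x, φ t := by
    intro φ ψ x hφ
    rw [funext hφ, intervalIntegral.integral_neg, integral_comp_neg, neg_zero,
      integral_symm 0 (-x), neg_neg]
  refine ⟨fun x => ?_, fun x => ?_⟩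
  · rw [key (fun t => Q t * y t + u t) _ x fun t => by ring]
    simpa using h.1 (-x)
  · rw [key (fun t => -(-(Q t) ^ 2 * y t - Q t * u t)) _ x fun t => by ring,
      intervalIntegral.integral_neg]
    simp only [neg_zero]
    rw [← neg_add]
    exact congrArg Neg.neg (h.2 (-x))

lemma SolvesWith.intervalIntegrable {Q y u : ℝ → ℝ} (hQ : LocL2 Q) (h : SolvesWith Q y u) (x : ℝ) :
    IntervalIntegrable (fun s => Q s * y s + u s) volume 0 x ∧
      IntervalIntegrable (fun s => -(Q s) ^ 2 * y s - Q s * u s) volume 0 x := by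
  rcases le_total 0 x with hx | hx
  · exact h.intervalIntegrable_of_nonneg hQ hx
  · obtain ⟨h1, h2⟩ := h.comp_neg.intervalIntegrable_of_nonneg hQ.neg_comp_neg (neg_nonneg.mpr hx)
    constructor
    · have := ((IntervalIntegrable.iff_comp_neg (by simp)).mp h1).neg
      simp only [neg_neg, neg_zero] at this
      convert this using 2
      simp
      ring
    · have := (IntervalIntegrable.iff_comp_neg (by simp)).mp h2
      simp only [neg_neg, neg_zero] at this
      convert this using 2
      ring

/-! ### Locally absolutely continuous functions with prescribed derivative -/

/-- `p` is locally absolutely continuous on `ℝ` with almost everywhere derivative `p'`. -/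
structure HasLocACDeriv (p p' : ℝ → ℝ) : Prop where
  ac : ∀ a b, AbsolutelyContinuousOnInterval p a b
  ae : ∀ᵐ x : ℝ, HasDerivAt p (p' x) x

namespace HasLocACDeriv

variable {p p' r r' : ℝ → ℝ}

lemma of_eq_primitive (hi : ∀ x, IntervalIntegrable p' volume 0 x)
    (hp : ∀ x, p x = p 0 + ∫ t in (0 : ℝ)..x, p' t) : HasLocACDeriv p p' := by
  have hi' : ∀ a b, IntervalIntegrable p' volume a b := fun a b => (hi a).symm.trans (hi b)
  have hpf : p = fun x => p 0 + ∫ t in (0 : ℝ)..x, p' t := funext hp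
  refine ⟨fun a b => ?_, ?_⟩
  · have hsub : uIcc a b ⊆ uIcc (min (min a b) 0) (max (max a b) 0) := by
      rw [uIcc, uIcc_of_le (by simp)]
      exact Icc_subset_Icc (min_le_left _ _) (le_max_left _ _)
    have hac := (hi' _ _).absolutelyContinuousOnInterval_intervalIntegral
      (a := min (min a b) 0) (b := max (max a b) 0) (c := 0) (by
        rw [uIcc_of_le (by simp)]; simp)
    rw [hpf]
    have hconst : AbsolutelyContinuousOnInterval (fun _ : ℝ => p 0) a b :=
      (LipschitzWith.const (p 0)).lipschitzOnWith.absolutelyContinuousOnInterval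
    exact hconst.fun_add (hac.mono hsub)
  · have hloc : LocallyIntegrable p' := by
      rw [locallyIntegrable_iff]
      intro k hk
      obtain ⟨a, ha⟩ := hk.bddBelow
      obtain ⟨b, hb⟩ := hk.bddAbove
      exact ((intervalIntegrable_iff' (by simp)).mp (hi' a b)).mono_set
        fun x hx => Icc_subset_uIcc ⟨ha hx, hb hx⟩
    filter_upwards [LocallyIntegrable.ae_hasDerivAt_integral hloc] with x hx
    rw [hpf]
    exact (hx 0).const_add _

lemma congr (h : HasLocACDeriv p p') (h' : ∀ x, p' x = r' x) : HasLocACDeriv p r' :=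
  funext h' ▸ h

lemma continuous (h : HasLocACDeriv p p') : Continuous p :=
  continuous_iff_continuousAt.mpr fun x => (h.ac (x - 1) (x + 1)).continuousOn.continuousAt (by
    rw [uIcc_of_le (by linarith)]; exact Icc_mem_nhds (by linarith) (by linarith))

lemma intervalIntegrable (h : HasLocACDeriv p p') (a b : ℝ) : IntervalIntegrable p' volume a b :=
  (h.ac a b).intervalIntegrable_deriv.congr_ae
    (ae_restrict_of_ae (h.ae.mono fun _ hx => hx.deriv))

lemma eq_add_integral (h : HasLocACDeriv p p') (a b : ℝ) : p b = p a + ∫ t in a..b, p' t := by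
  rw [← integral_congr_ae (h.ae.mono fun _ hx _ => hx.deriv), (h.ac a b).integral_deriv_eq_sub]
  ring

lemma const (c : ℝ) : HasLocACDeriv (fun _ => c) fun _ => 0 :=
  ⟨fun _ _ => (LipschitzWith.const c).lipschitzOnWith.absolutelyContinuousOnInterval,
    ae_of_all _ fun x => hasDerivAt_const x c⟩

lemma add (h : HasLocACDeriv p p') (hr : HasLocACDeriv r r') :
    HasLocACDeriv (fun x => p x + r x) fun x => p' x + r' x :=
  ⟨fun a b => (h.ac a b).fun_add (hr.ac a b), h.ae.mp (hr.ae.mono fun _ h₂ h₁ => h₁.add h₂)⟩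

lemma sub (h : HasLocACDeriv p p') (hr : HasLocACDeriv r r') :
    HasLocACDeriv (fun x => p x - r x) fun x => p' x - r' x :=
  ⟨fun a b => (h.ac a b).fun_sub (hr.ac a b), h.ae.mp (hr.ae.mono fun _ h₂ h₁ => h₁.sub h₂)⟩

lemma mul (h : HasLocACDeriv p p') (hr : HasLocACDeriv r r') :
    HasLocACDeriv (fun x => p x * r x) fun x => p' x * r x + p x * r' x :=
  ⟨fun a b => (h.ac a b).fun_mul (hr.ac a b), h.ae.mp (hr.ae.mono fun _ h₂ h₁ => h₁.mul h₂)⟩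

lemma const_mul (c : ℝ) (h : HasLocACDeriv p p') :
    HasLocACDeriv (fun x => c * p x) fun x => c * p' x :=
  ⟨fun a b => (h.ac a b).const_mul c, h.ae.mono fun _ hx => hx.const_mul c⟩

lemma inv (h : HasLocACDeriv p p') (hpos : ∀ x, 0 < p x) :
    HasLocACDeriv (fun x => (p x)⁻¹) fun x => -p' x / p x ^ 2 := by
  refine ⟨fun a b => ?_, h.ae.mono fun x hx => hx.inv (hpos x).ne'⟩
  obtain ⟨z, -, hz⟩ := isCompact_uIcc.exists_isMinOn (nonempty_uIcc (a := a) (b := b))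
    h.continuous.continuousOn
  have hm : ∀ x ∈ uIcc a b, p z ≤ p x := fun x hx => hz hx
  have hz0 := hpos z
  have hlip : ∀ x ∈ uIcc a b, ∀ w ∈ uIcc a b,
      dist (p x)⁻¹ (p w)⁻¹ ≤ (p z ^ 2)⁻¹ * dist (p x) (p w) := by
    intro x hx w hw
    have hx0 := hpos x
    have hw0 := hpos w
    rw [Real.dist_eq, Real.dist_eq, inv_sub_inv hx0.ne' hw0.ne', abs_div,
      abs_of_pos (mul_pos hx0 hw0), abs_sub_comm, div_eq_inv_mul]
    refine mul_le_mul_of_nonneg_right (inv_anti₀ (by positivity) ?_) (abs_nonneg _)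
    rw [sq]
    exact mul_le_mul (hm x hx) (hm w hw) hz0.le hx0.le
  have hac := h.ac a b
  rw [absolutelyContinuousOnInterval_iff] at hac ⊢
  intro ε hε
  obtain ⟨δ, hδ, hE⟩ := hac (p z ^ 2 * ε) (by positivity)
  refine ⟨δ, hδ, fun E hEd hlen => ?_⟩
  calc _ ≤ ∑ i ∈ Finset.range E.1, (p z ^ 2)⁻¹ * dist (p (E.2 i).1) (p (E.2 i).2) :=
        Finset.sum_le_sum fun i hi => hlip _ (hEd.1 i hi).1 _ (hEd.1 i hi).2
    _ = (p z ^ 2)⁻¹ * ∑ i ∈ Finset.range E.1, dist (p (E.2 i).1) (p (E.2 i).2) := by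
        rw [Finset.mul_sum]
    _ < (p z ^ 2)⁻¹ * (p z ^ 2 * ε) := by
        gcongr
        exact hE E hEd hlen
    _ = ε := by field_simp

lemma of_continuous (hp : Continuous p) : HasLocACDeriv (fun x => ∫ t in (0 : ℝ)..x, p t) p :=
  of_eq_primitive (fun x => hp.intervalIntegrable 0 x) fun x => by simp

end HasLocACDeriv

/-! ### Solutions built from a positive solution -/

lemma solvesWith_iff {Q y u : ℝ → ℝ} (hQ : LocL2 Q) :
    SolvesWith Q y u ↔ HasLocACDeriv y (fun t => Q t * y t + u t) ∧
      HasLocACDeriv u (fun t => -(Q t) ^ 2 * y t - Q t * u t) :=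
  ⟨fun h => ⟨.of_eq_primitive (fun x => (h.intervalIntegrable hQ x).1) h.1,
    .of_eq_primitive (fun x => (h.intervalIntegrable hQ x).2) h.2⟩,
    fun h => ⟨h.1.eq_add_integral 0, h.2.eq_add_integral 0⟩⟩

section PositiveSolution

variable {Q y₁ u₁ F : ℝ → ℝ}

lemma SolvesWith.hasLocACDeriv_primitive (hQ : LocL2 Q) (h₁ : SolvesWith Q y₁ u₁)
    (h₁pos : ∀ x, 0 < y₁ x) (hF : ∀ x, F x = ∫ s in (0 : ℝ)..x, (y₁ s ^ 2)⁻¹) :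
    HasLocACDeriv F fun x => (y₁ x ^ 2)⁻¹ := by
  rw [funext hF]
  exact .of_continuous ((((solvesWith_iff hQ).mp h₁).1.continuous.pow 2).inv₀
    fun x => (pow_pos (h₁pos x) 2).ne')

/-- Reduction of order: `y₁ (1 + c F)` is again a solution. -/
lemma SolvesWith.mul_one_add_mul_primitive (hQ : LocL2 Q) (h₁ : SolvesWith Q y₁ u₁)
    (h₁pos : ∀ x, 0 < y₁ x) (hF : ∀ x, F x = ∫ s in (0 : ℝ)..x, (y₁ s ^ 2)⁻¹) (c : ℝ) :
    SolvesWith Q (fun x => y₁ x * (1 + c * F x))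
      (fun x => u₁ x * (1 + c * F x) + c * (y₁ x)⁻¹) := by
  have hFd := h₁.hasLocACDeriv_primitive hQ h₁pos hF
  obtain ⟨hy, hu⟩ := (solvesWith_iff hQ).mp h₁
  have hfac := (HasLocACDeriv.const 1).add (hFd.const_mul c)
  refine (solvesWith_iff hQ).mpr ⟨(hy.mul hfac).congr fun x => ?_,
    ((hu.mul hfac).add ((hy.inv h₁pos).const_mul c)).congr fun x => ?_⟩
  · have := (h₁pos x).ne'
    field_simp
    ring
  · have := (h₁pos x).ne'
    field_simp
    ring

/-- The Wronskian of two solutions is constant. -/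
lemma SolvesWith.wronskian_eq {y u : ℝ → ℝ} (hQ : LocL2 Q) (h₁ : SolvesWith Q y₁ u₁)
    (h : SolvesWith Q y u) (x : ℝ) :
    u x * y₁ x - u₁ x * y x = u 0 * y₁ 0 - u₁ 0 * y 0 := by
  obtain ⟨hy₁, hu₁⟩ := (solvesWith_iff hQ).mp h₁
  obtain ⟨hy, hu⟩ := (solvesWith_iff hQ).mp h
  have hW : HasLocACDeriv (fun x => u x * y₁ x - u₁ x * y x) fun _ => 0 :=
    ((hu.mul hy₁).sub (hu₁.mul hy)).congr fun x => by ring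
  simpa using hW.eq_add_integral 0 x

lemma SolvesWith.eq_mul_one_add_mul_primitive {y u : ℝ → ℝ} (hQ : LocL2 Q)
    (h₁ : SolvesWith Q y₁ u₁) (h₁pos : ∀ x, 0 < y₁ x) (h₁0 : y₁ 0 = 1)
    (hF : ∀ x, F x = ∫ s in (0 : ℝ)..x, (y₁ s ^ 2)⁻¹) (h : SolvesWith Q y u) (h0 : y 0 = 1)
    (x : ℝ) : y x = y₁ x * (1 + (u 0 - u₁ 0) * F x) := by
  have hy₁ := ((solvesWith_iff hQ).mp h₁).1
  have hy := ((solvesWith_iff hQ).mp h).1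
  have hq : HasLocACDeriv (fun x => y x * (y₁ x)⁻¹) fun x => (u 0 - u₁ 0) * (y₁ x ^ 2)⁻¹ := by
    refine (hy.mul (hy₁.inv h₁pos)).congr fun x => ?_
    have hW := h₁.wronskian_eq hQ h x
    rw [h₁0, h0, mul_one, mul_one] at hW
    have := (h₁pos x).ne'
    rw [← hW]
    field_simp
    ring
  have e := hq.eq_add_integral 0 x
  have := (h₁pos x).ne'
  rw [intervalIntegral.integral_const_mul, ← hF, h₁0, h0] at e
  field_simp at e
  simpa using e

end PositiveSolution

/-! ### Positivity of `1 + c F` -/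

lemma ofReal_lt_of_tendsto {G : ℝ → ℝ} (hG : StrictMono G) (hG0 : G 0 = 0) {m : ℝ≥0∞}
    (hm : Tendsto (fun x => ENNReal.ofReal (G x)) atTop (nhds m)) {x : ℝ} (hx : 0 ≤ x) :
    ENNReal.ofReal (G x) < m :=
  ((ENNReal.ofReal_lt_ofReal_iff (hG0 ▸ hG (by linarith))).mpr (hG (lt_add_one x))).trans_le
    ((ENNReal.ofReal_mono.comp hG.monotone).ge_of_tendsto hm (x + 1))

lemma inv_toReal_pos_of_tendsto {G : ℝ → ℝ} (hG : StrictMono G) (hG0 : G 0 = 0) {m : ℝ≥0∞}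
    (hm : Tendsto (fun x => ENNReal.ofReal (G x)) atTop (nhds m)) (hm' : m ≠ ⊤) :
    0 < m⁻¹.toReal :=
  ENNReal.toReal_pos (ENNReal.inv_ne_zero.mpr hm')
    (ENNReal.inv_ne_top.mpr (zero_le.trans_lt (ofReal_lt_of_tendsto hG hG0 hm le_rfl)).ne')

lemma StrictMono.neg_comp_neg {G : ℝ → ℝ} (hG : StrictMono G) : StrictMono fun x => -G (-x) :=
  fun _ _ hxz => neg_lt_neg (hG (neg_lt_neg hxz))

lemma forall_nonneg_one_add_mul_pos_iff {G : ℝ → ℝ} (hG : StrictMono G) (hG0 : G 0 = 0)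
    {m : ℝ≥0∞} (hm : Tendsto (fun x => ENNReal.ofReal (G x)) atTop (nhds m)) (c : ℝ) :
    (∀ x, 0 ≤ x → 0 < 1 + c * G x) ↔ -(m⁻¹.toReal) ≤ c := by
  have hlt : ∀ x, 0 ≤ x → ENNReal.ofReal (G x) < m := fun x hx =>
    ofReal_lt_of_tendsto hG hG0 hm hx
  have hm0 : m ≠ 0 := (zero_le.trans_lt (hlt 0 le_rfl)).ne'
  have hGnn : ∀ x, 0 ≤ x → 0 ≤ G x := fun x hx => hG0 ▸ hG.monotone hx
  rcases le_or_gt 0 c with hc | hc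
  · refine iff_of_true (fun x hx => ?_) ((neg_nonpos.mpr ENNReal.toReal_nonneg).trans hc)
    have := mul_nonneg hc (hGnn x hx)
    linarith
  have hc' : 0 < -c := neg_pos.mpr hc
  have hbound : ∀ x, 0 < 1 + c * G x ↔ G x < (-c)⁻¹ := fun x => by
    rw [← mul_lt_mul_iff_of_pos_left (b := G x) hc', mul_inv_cancel₀ hc'.ne']
    constructor <;> intro h <;> linarith
  constructor
  · intro h
    have hmle : m ≤ ENNReal.ofReal (-c)⁻¹ := by
      refine le_of_tendsto hm ((eventually_ge_atTop 0).mono fun x hx => ?_)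
      exact ENNReal.ofReal_le_ofReal ((hbound x).mp (h x hx)).le
    rw [ENNReal.ofReal_inv_of_pos hc', ENNReal.le_inv_iff_le_inv] at hmle
    have := (ENNReal.ofReal_le_iff_le_toReal (ENNReal.inv_ne_top.mpr hm0)).mp hmle
    linarith
  · intro h x hx
    have hmle : ENNReal.ofReal (-c) ≤ m⁻¹ :=
      (ENNReal.ofReal_le_iff_le_toReal (ENNReal.inv_ne_top.mpr hm0)).mpr (by linarith)
    rw [ENNReal.le_inv_iff_le_inv, ← ENNReal.ofReal_inv_of_pos hc'] at hmle
    exact (hbound x).mpr ((ENNReal.ofReal_lt_ofReal_iff (inv_pos.mpr hc')).mp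
      ((hlt x hx).trans_le hmle))

lemma forall_one_add_mul_pos_iff {F : ℝ → ℝ} (hF : StrictMono F) (hF0 : F 0 = 0) {mp mm : ℝ≥0∞}
    (hmp : Tendsto (fun x => ENNReal.ofReal (F x)) atTop (nhds mp))
    (hmm : Tendsto (fun x => ENNReal.ofReal (-F x)) atBot (nhds mm)) (c : ℝ) :
    (∀ x, 0 < 1 + c * F x) ↔ c ∈ Icc (-(mp⁻¹.toReal)) (mm⁻¹.toReal) := by
  have h₁ := forall_nonneg_one_add_mul_pos_iff hF hF0 hmp c
  have h₂ := forall_nonneg_one_add_mul_pos_iff hF.neg_comp_neg (by simp [hF0])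
    (hmm.comp tendsto_neg_atTop_atBot) (-c)
  rw [mem_Icc, ← h₁, ← neg_le_neg_iff (a := mm⁻¹.toReal), ← h₂]
  refine ⟨fun h => ⟨fun x _ => h x, fun x _ => by simpa using h (-x)⟩, fun h x => ?_⟩
  rcases le_total 0 x with hx | hx
  · exact h.1 x hx
  · simpa using h.2 (-x) (neg_nonneg.mpr hx)

/-- **Structure of the set `Pos(q)` of normalized positive solutions.**
Let `y₁` be a solution of `L_q y = 0` with `y₁ > 0` and `y₁ 0 = 1`, let
`F x = ∫₀ˣ y₁(s)⁻² ds`, and let `m₊ = lim_{x→+∞} F x ∈ (0,∞]`, `m₋ = -lim_{x→-∞} F x ∈ (0,∞]`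
(as extended nonnegative reals, with the convention `∞⁻¹ = 0`). Then:
(1) `y` is a solution with `y > 0` and `y 0 = 1` iff `y = y₁ · (1 + c F)` for some
`c ∈ [-m₊⁻¹, m₋⁻¹]`;
(2) if `m₊ = m₋ = ∞` then `Pos(q) = {y₁}` is a single point;
(3) otherwise `Pos(q) = {θ y₊ + (1-θ) y₋ : θ ∈ [0,1]}` with
`y₊ = y₁ (1 - m₊⁻¹ F)` and `y₋ = y₁ (1 + m₋⁻¹ F)`. -/
theorem pos_solutions_structure (Q y₁ : ℝ → ℝ) (hQ : LocL2 Q)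
    (h₁ : Solves Q y₁) (h₁pos : ∀ x : ℝ, 0 < y₁ x) (h₁0 : y₁ 0 = 1)
    (F : ℝ → ℝ) (hF : ∀ x : ℝ, F x = ∫ s in (0:ℝ)..x, (y₁ s ^ 2)⁻¹)
    (mp mm : ℝ≥0∞)
    (hmp : Tendsto (fun x => ENNReal.ofReal (F x)) atTop (nhds mp))
    (hmm : Tendsto (fun x => ENNReal.ofReal (-F x)) atBot (nhds mm)) :
    (∀ y : ℝ → ℝ,
      (Solves Q y ∧ (∀ x : ℝ, 0 < y x) ∧ y 0 = 1) ↔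
      (∃ c ∈ Set.Icc (-(mp⁻¹.toReal)) (mm⁻¹.toReal),
        ∀ x : ℝ, y x = y₁ x * (1 + c * F x))) ∧
    (mp = ⊤ ∧ mm = ⊤ →
      {y : ℝ → ℝ | Solves Q y ∧ (∀ x : ℝ, 0 < y x) ∧ y 0 = 1} = {y₁}) ∧
    (mp ≠ ⊤ ∨ mm ≠ ⊤ →
      {y : ℝ → ℝ | Solves Q y ∧ (∀ x : ℝ, 0 < y x) ∧ y 0 = 1} =
        {y : ℝ → ℝ | ∃ θ ∈ Set.Icc (0:ℝ) 1, ∀ x : ℝ,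
          y x = θ * (y₁ x * (1 - mp⁻¹.toReal * F x))
              + (1 - θ) * (y₁ x * (1 + mm⁻¹.toReal * F x))}) := by
  obtain ⟨u₁, h₁⟩ := h₁
  have hFd := h₁.hasLocACDeriv_primitive hQ h₁pos hF
  have hF0 : F 0 = 0 := by simp [hF]
  have hFmono : StrictMono F := fun a b hab => by
    rw [hFd.eq_add_integral a b]
    have := intervalIntegral_pos_of_pos (hFd.intervalIntegrable a b)
      (fun x => inv_pos.mpr (pow_pos (h₁pos x) 2)) hab
    linarith
  have hpos := forall_one_add_mul_pos_iff hFmono hF0 hmp hmm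
  have main : ∀ y : ℝ → ℝ, (Solves Q y ∧ (∀ x : ℝ, 0 < y x) ∧ y 0 = 1) ↔
      (∃ c ∈ Set.Icc (-(mp⁻¹.toReal)) (mm⁻¹.toReal), ∀ x : ℝ, y x = y₁ x * (1 + c * F x)) := by
    intro y
    constructor
    · rintro ⟨⟨u, hu⟩, hy, hy0⟩
      have hyF := h₁.eq_mul_one_add_mul_primitive hQ h₁pos h₁0 hF hu hy0
      exact ⟨u 0 - u₁ 0, (hpos _).mp fun x =>
        (mul_pos_iff_of_pos_left (h₁pos x)).mp (hyF x ▸ hy x), hyF⟩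
    · rintro ⟨c, hc, hy⟩
      rw [funext hy]
      exact ⟨⟨_, h₁.mul_one_add_mul_primitive hQ h₁pos hF c⟩,
        fun x => mul_pos (h₁pos x) ((hpos c).mpr hc x), by simp [hF0, h₁0]⟩
  refine ⟨main, ?_, fun hfin => ?_⟩
  · rintro ⟨rfl, rfl⟩
    ext y
    rw [mem_ofPred_eq, main]
    simp [funext_iff]
  · ext y
    rw [mem_ofPred_eq, main, mem_ofPred_eq]
    set A := mp⁻¹.toReal with hA
    set B := mm⁻¹.toReal with hB
    have hA0 : 0 ≤ A := ENNReal.toReal_nonneg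
    have hB0 : 0 ≤ B := ENNReal.toReal_nonneg
    have hAB : 0 < A + B := by
      rcases hfin with h | h
      · exact add_pos_of_pos_of_nonneg (inv_toReal_pos_of_tendsto hFmono hF0 hmp h) hB0
      · exact add_pos_of_nonneg_of_pos hA0 (inv_toReal_pos_of_tendsto hFmono.neg_comp_neg
          (by simp [hF0]) (hmm.comp tendsto_neg_atTop_atBot) h)
    constructor
    · rintro ⟨c, hc, hy⟩
      refine ⟨(B - c) / (A + B), ⟨div_nonneg (by linarith [hc.2]) hAB.le,
        (div_le_one hAB).mpr (by linarith [hc.1])⟩, fun x => ?_⟩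
      rw [hy x]
      field_simp
      ring
    · rintro ⟨θ, hθ, hy⟩
      refine ⟨-θ * A + (1 - θ) * B, ⟨?_, ?_⟩, fun x => by rw [hy x]; ring⟩
      · nlinarith [hθ.1, hθ.2]
      · nlinarith [hθ.1, hθ.2]
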